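/- If K is a field, then Λ_{≥0} is a subring of Λ, and Λ is the field of fractions of Λ_{≥0}: Λ is a field and every element of Λ can be written as u · v⁻¹ with u, v ∈ Λ_{≥0} and v ≠ 0 (for instance one may take v = T^a for suitable a ≥ 0). -/

import Mathlib

/-- The carrier of the universal Novikov field `Λ` over `K`. -/
abbrev NovikovField (K : Type*) [Field K] : Type _ :=
  {f : ℝ → K // ∀ C : ℝ, {a : ℝ | a ≤ C ∧ f a ≠ 0}.Finite}

/-- The subset `Λ_{≥0} ⊆ Λ` of series supported in `[0,∞)`. -/
def NovikovNonneg (K : Type*) [Field K] : Set (NovikovField K) :=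
  {f | ∀ a : ℝ, a < 0 → f.val a = 0}

/-- The monomial `T^a ∈ Λ`, supported at `{a}` with value `1`. -/
noncomputable def NovT (K : Type*) [Field K] (a : ℝ) : NovikovField K :=
  ⟨fun b => if b = a then 1 else 0, by
    intro C
    apply Set.Finite.subset (Set.finite_singleton a)
    rintro b ⟨-, hb⟩
    by_contra hba
    exact hb (if_neg hba)⟩

open scoped HahnSeries

theorem HahnSeries.coeff_mul_eq_finsum {Γ R : Type*} [AddCommGroup Γ] [LinearOrder Γ]
    [IsOrderedAddMonoid Γ] [NonUnitalNonAssocSemiring R] (x y : R⟦Γ⟧) (a : Γ) :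
    (x * y).coeff a = ∑ᶠ b : Γ, x.coeff b * y.coeff (a - b) := by
  classical
  rw [HahnSeries.coeff_mul, finsum_eq_sum_of_support_subset (s := Finset.image Prod.fst
    (Finset.antidiagonal x.isPWO_support y.isPWO_support a))]
  · rw [Finset.sum_image]
    · refine Finset.sum_congr rfl fun p hp => ?_
      rw [Finset.mem_antidiagonal] at hp
      rw [← hp.2.2, add_sub_cancel_left]
    · intro p hp q hq h
      simp only [Finset.mem_coe, Finset.mem_antidiagonal] at hp hq
      refine Prod.ext h (add_left_cancel (a := p.1) ?_)
      rw [hp.2.2, h, hq.2.2]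
  · intro b hb
    simp only [Finset.coe_image, Set.mem_image, Finset.mem_coe, Finset.mem_antidiagonal]
    exact ⟨(b, a - b), ⟨left_ne_zero_of_mul hb, right_ne_zero_of_mul hb, by simp⟩, rfl⟩

/-- The support of `f` meets every left half-line in a finite set. -/
def IsLeftFinite {K : Type*} [Zero K] (f : ℝ → K) : Prop :=
  ∀ C : ℝ, {a : ℝ | a ≤ C ∧ f a ≠ 0}.Finite

namespace IsLeftFinite

variable {K : Type*}

theorem isPWO_support [Zero K] {f : ℝ → K} (hf : IsLeftFinite f) :
    (Function.support f).IsPWO := by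
  rw [Set.isPWO_iff_isWF, Set.isWF_iff_no_descending_seq]
  intro u hu hmem
  exact Set.infinite_range_of_injective hu.injective <| (hf (u 0)).subset <| by
    rintro _ ⟨n, rfl⟩
    exact ⟨hu.antitone n.zero_le, hmem n⟩

theorem of_support_subset [Zero K] {L : Type*} [Zero L] {f : ℝ → K} {g : ℝ → L}
    (hf : IsLeftFinite f) (h : ∀ a, g a ≠ 0 → f a ≠ 0) : IsLeftFinite g :=
  fun C => (hf C).subset fun a ha => ⟨ha.1, h a ha.2⟩

theorem exists_lowerBound [Zero K] {f : ℝ → K} (hf : IsLeftFinite f) :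
    ∃ m, ∀ a, f a ≠ 0 → m ≤ a := by
  obtain ⟨m, hm⟩ := (hf 0).bddBelow
  refine ⟨min m 0, fun a ha => ?_⟩
  rcases le_total a 0 with h | h
  · exact (min_le_left _ _).trans (hm ⟨h, ha⟩)
  · exact (min_le_right _ _).trans h

theorem add [AddMonoid K] {x y : K⟦ℝ⟧} (hx : IsLeftFinite x.coeff)
    (hy : IsLeftFinite y.coeff) : IsLeftFinite (x + y).coeff := by
  refine fun C => ((hx C).union (hy C)).subset fun a ha => ?_
  rcases HahnSeries.support_add_subset x y ha.2 with h | h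
  · exact Or.inl ⟨ha.1, h⟩
  · exact Or.inr ⟨ha.1, h⟩

theorem mul [NonUnitalNonAssocSemiring K] {x y : K⟦ℝ⟧} (hx : IsLeftFinite x.coeff)
    (hy : IsLeftFinite y.coeff) : IsLeftFinite (x * y).coeff := by
  obtain ⟨m, hm⟩ := hx.exists_lowerBound
  obtain ⟨n, hn⟩ := hy.exists_lowerBound
  refine fun C => ((hx (C - n)).add (hy (C - m))).subset fun a ha => ?_
  obtain ⟨b, hb, c, hc, rfl⟩ := HahnSeries.support_mul_subset ha.2
  have h₁ := hm b hb
  have h₂ := hn c hc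
  have h₃ : b + c ≤ C := ha.1
  exact ⟨b, ⟨by linarith, hb⟩, c, ⟨by linarith, hc⟩, rfl⟩

/-- Beyond its least element, the support of a left-finite function starts after a gap. -/
theorem exists_gap [Zero K] {f : ℝ → K} (hf : IsLeftFinite f) (d : ℝ) :
    ∃ ε > 0, ∀ b, d < b → f b ≠ 0 → d + ε ≤ b := by
  have hF : ({b | b ≤ d + 1 ∧ f b ≠ 0} \ {d}).Finite := (hf (d + 1)).sdiff
  obtain ⟨ε, hε, h⟩ := Metric.isOpen_iff.mp hF.isClosed.isOpen_compl d (by simp)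
  refine ⟨min ε 1, lt_min hε one_pos, fun b hb hfb => ?_⟩
  by_contra! hlt
  have h₁ := min_le_left ε 1
  have h₂ := min_le_right ε 1
  refine h (a := b) ?_ ⟨⟨by linarith, hfb⟩, hb.ne'⟩
  rw [Metric.mem_ball, Real.dist_eq, abs_of_pos (by linarith)]
  linarith

theorem inv [Field K] {x : K⟦ℝ⟧} (hx : IsLeftFinite x.coeff) :
    IsLeftFinite (x⁻¹).coeff := by
  rcases eq_or_ne x 0 with rfl | h0
  · simp [IsLeftFinite]
  set z := x⁻¹
  set d := x.order
  have hd : x.coeff d ≠ 0 := HahnSeries.coeff_order_eq_zero.not.mpr h0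
  obtain ⟨ε, hε, hgap⟩ := hx.exists_gap d
  have hxz : x * z = 1 := mul_inv_cancel₀ h0
  have key : ∀ a, z.coeff a ≠ 0 →
      a = -d ∨ ∃ b, d + ε ≤ b ∧ x.coeff b ≠ 0 ∧ z.coeff (a + d - b) ≠ 0 := by
    intro a ha
    by_contra! hcon
    obtain ⟨had, hcon⟩ := hcon
    have h1 := HahnSeries.coeff_mul_eq_finsum x z (a + d)
    rw [hxz, HahnSeries.coeff_one, if_neg (fun h => had (by linarith)),
      finsum_eq_single _ d] at h1
    · rw [add_sub_cancel_right] at h1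
      exact mul_ne_zero hd ha h1.symm
    · intro b hb
      by_cases hxb : x.coeff b = 0
      · rw [hxb, zero_mul]
      · have hdb : d < b := lt_of_le_of_ne (HahnSeries.order_le_of_coeff_ne_zero hxb) hb.symm
        rw [hcon b (hgap b hdb hxb) hxb, mul_zero]
  have step : ∀ n : ℕ, {a | a ≤ z.order + n * ε ∧ z.coeff a ≠ 0}.Finite := by
    intro n
    induction n with
    | zero =>
      refine (Set.finite_singleton z.order).subset fun a ha => ?_
      have h := ha.1
      rw [Nat.cast_zero, zero_mul, add_zero] at h
      exact le_antisymm h (HahnSeries.order_le_of_coeff_ne_zero ha.2)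
    | succ n ih =>
      refine (((hx (d + (n + 1) * ε)).image2 (fun b c => b + c - d) ih).insert (-d)).subset
        fun a ha => ?_
      have ha₁ := ha.1
      push_cast at ha₁
      rcases key a ha.2 with h | ⟨b, hb, hxb, hzb⟩
      · exact Or.inl h
      · have := HahnSeries.order_le_of_coeff_ne_zero hzb
        refine Or.inr ⟨b, ⟨by linarith, hxb⟩, a + d - b, ⟨by linarith, hzb⟩, ?_⟩
        dsimp only
        ring
  intro C
  obtain ⟨n, hn⟩ := exists_nat_ge ((C - z.order) / ε)
  rw [div_le_iff₀ hε] at hn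
  exact (step n).subset fun a ha => ⟨by linarith [ha.1], ha.2⟩

theorem one [MulZeroOneClass K] : IsLeftFinite (1 : K⟦ℝ⟧).coeff := by
  refine fun C => (Set.finite_singleton 0).subset fun a ha => ?_
  by_contra h
  exact ha.2 (HahnSeries.coeff_one.trans (if_neg h))

end IsLeftFinite

/-- The universal Novikov field as a subfield of the field of Hahn series over `ℝ`. -/
noncomputable def novikovSubfield (K : Type*) [Field K] : Subfield K⟦ℝ⟧ where
  carrier := {x | IsLeftFinite x.coeff}
  mul_mem' := IsLeftFinite.mul
  one_mem' := IsLeftFinite.one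
  add_mem' := IsLeftFinite.add
  zero_mem' := by simp [IsLeftFinite]
  neg_mem' hx := hx.of_support_subset fun a ha => by simpa using ha
  inv_mem' _ := IsLeftFinite.inv

/-- Elements of the universal Novikov field are the Hahn series with left-finite coefficients. -/
noncomputable def novikovEquiv (K : Type*) [Field K] : NovikovField K ≃ novikovSubfield K where
  toFun f := ⟨⟨f.val, IsLeftFinite.isPWO_support f.2⟩, f.2⟩
  invFun x := ⟨x.1.coeff, x.2⟩
  left_inv _ := rfl
  right_inv _ := rfl

/-- If `K` is a field then (for the pointwise addition and convolution multiplication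
making `Λ` a field) the subset `Λ_{≥0}` is a subring of `Λ`, and `Λ` is the field of
fractions of `Λ_{≥0}`: every `x ∈ Λ` can be written as `u · v⁻¹` with `u, v ∈ Λ_{≥0}`,
`v ≠ 0`, and indeed one may take `v = T^a` for a suitable `a ≥ 0`. -/
theorem novikov_field_is_fraction_field (K : Type*) [Field K] :
    ∃ fieldI : Field (NovikovField K),
      letI := fieldI
      (∀ f g : NovikovField K, ∀ a : ℝ, (f + g).val a = f.val a + g.val a) ∧
      (∀ f g : NovikovField K, ∀ a : ℝ,
        (f * g).val a = ∑ᶠ b : ℝ, f.val b * g.val (a - b)) ∧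
      (∃ S : Subring (NovikovField K), (S : Set (NovikovField K)) = NovikovNonneg K) ∧
      (∀ x : NovikovField K, ∃ u v : NovikovField K,
        u ∈ NovikovNonneg K ∧ v ∈ NovikovNonneg K ∧ v ≠ 0 ∧ x = u * v⁻¹ ∧
        ∃ a : ℝ, 0 ≤ a ∧ v = NovT K a) := by
  let fieldI : Field (NovikovField K) := (novikovEquiv K).field
  have hadd : ∀ f g : NovikovField K, ∀ a : ℝ, (f + g).val a = f.val a + g.val a :=
    fun f g a => rfl
  have hmul : ∀ f g : NovikovField K, ∀ a : ℝ,
      (f * g).val a = ∑ᶠ b : ℝ, f.val b * g.val (a - b) :=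
    fun f g a => HahnSeries.coeff_mul_eq_finsum (novikovEquiv K f).1 (novikovEquiv K g).1 a
  have hone : ∀ a : ℝ, (1 : NovikovField K).val a = if a = 0 then 1 else 0 :=
    fun a => HahnSeries.coeff_one
  have hzero : ∀ a : ℝ, (0 : NovikovField K).val a = 0 := fun a => rfl
  have hneg : ∀ f : NovikovField K, ∀ a : ℝ, (-f).val a = -f.val a := fun f a => rfl
  refine ⟨fieldI, hadd, hmul, ⟨{
      carrier := NovikovNonneg K
      mul_mem' := ?_
      one_mem' := fun a ha => by rw [hone, if_neg ha.ne]
      add_mem' := fun hf hg a ha => by rw [hadd, hf a ha, hg a ha, add_zero]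
      zero_mem' := fun a _ => hzero a
      neg_mem' := fun hf a ha => by rw [hneg, hf a ha, neg_zero] }, rfl⟩, ?_⟩
  · intro f g hf hg a ha
    rw [hmul]
    refine finsum_eq_zero_of_forall_eq_zero fun b => ?_
    rcases lt_or_ge b 0 with hb | hb
    · rw [hf b hb, zero_mul]
    · rw [hg (a - b) (by linarith), mul_zero]
  · intro x
    obtain ⟨m, hm⟩ := IsLeftFinite.exists_lowerBound x.2
    have hT : NovT K (max 0 (-m)) ≠ 0 := by
      intro h
      have h' := congrArg (fun f : NovikovField K => f.val (max 0 (-m))) h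
      simp [NovT, hzero] at h'
    refine ⟨x * NovT K (max 0 (-m)), NovT K (max 0 (-m)), fun a ha => ?_, fun a ha => ?_, hT,
      (mul_inv_cancel_right₀ hT x).symm, _, le_max_left _ _, rfl⟩
    · rw [hmul]
      refine finsum_eq_zero_of_forall_eq_zero fun b => ?_
      by_contra hb
      have h₁ := hm b (left_ne_zero_of_mul hb)
      have h₂ : a - b = max 0 (-m) := by
        by_contra h
        exact right_ne_zero_of_mul hb (if_neg h)
      linarith [le_max_right 0 (-m)]
    · exact if_neg (ha.trans_le (le_max_left _ _)).ne
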